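/- Let S, P, Q be pairwise disjoint finite sets and let V₁, V₂ be vector spaces on S⊎P and P⊎Q over a field F. Then r(V₁) + r(V₂) = r(V₁ + V₂) + r(V₁×P ∩ V₂×P), where V₁ + V₂ is the extended sum on S⊎P⊎Q and V₁×P ∩ V₂×P is the ordinary intersection of subspaces of F^P. -/

import Mathlib

namespace ILA

variable {F : Type*} [Field F]

/-- Restriction of a collection on `X ⊎ Y` to its left component `X`. -/
def restrL {X Y : Type*} (K : Set (X ⊕ Y → F)) : Set (X → F) :=
  {f | ∃ g : Y → F, Sum.elim f g ∈ K}

/-- Contraction of a collection on `X ⊎ Y` to its left component `X`. -/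
def contrL {X Y : Type*} (K : Set (X ⊕ Y → F)) : Set (X → F) :=
  {f | Sum.elim f (0 : Y → F) ∈ K}

/-- Restriction of a collection on `X ⊎ Y` to its right component `Y`. -/
def restrR {X Y : Type*} (K : Set (X ⊕ Y → F)) : Set (Y → F) :=
  {g | ∃ f : X → F, Sum.elim f g ∈ K}

/-- Contraction of a collection on `X ⊎ Y` to its right component `Y`. -/
def contrR {X Y : Type*} (K : Set (X ⊕ Y → F)) : Set (Y → F) :=
  {g | Sum.elim (0 : X → F) g ∈ K}

/-- Matched composition of a collection on `S ⊎ P` with one on `P ⊎ Q`. -/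
def matched {S P Q : Type*} (K₁ : Set (S ⊕ P → F)) (K₂ : Set (P ⊕ Q → F)) :
    Set (S ⊕ Q → F) :=
  {h | ∃ p : P → F, Sum.elim (h ∘ Sum.inl) p ∈ K₁ ∧ Sum.elim p (h ∘ Sum.inr) ∈ K₂}

/-- Skewed composition of a collection on `S ⊎ P` with one on `P ⊎ Q`. -/
def skewed {S P Q : Type*} (K₁ : Set (S ⊕ P → F)) (K₂ : Set (P ⊕ Q → F)) :
    Set (S ⊕ Q → F) :=
  {h | ∃ p : P → F, Sum.elim (h ∘ Sum.inl) p ∈ K₁ ∧ Sum.elim (-p) (h ∘ Sum.inr) ∈ K₂}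

/-- Matched composition of a collection on `S ⊎ P` with one on `P` (i.e. `Q = ∅`). -/
def matchedP {S P : Type*} (K₁ : Set (S ⊕ P → F)) (K₂ : Set (P → F)) : Set (S → F) :=
  {f | ∃ p ∈ K₂, Sum.elim f p ∈ K₁}

/-- Matched composition over the common left component `S` of collections on
`S ⊎ P` and `S ⊎ Q`; the result lives on `P ⊎ Q`. -/
def matchedL {S P Q : Type*} (K₁ : Set (S ⊕ P → F)) (K₂ : Set (S ⊕ Q → F)) :
    Set (P ⊕ Q → F) :=
  {h | ∃ s : S → F, Sum.elim s (h ∘ Sum.inl) ∈ K₁ ∧ Sum.elim s (h ∘ Sum.inr) ∈ K₂}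

/-- The collection of vectors orthogonal (w.r.t. the standard dot product)
to every vector of `K`. -/
def dualSet {X : Type*} [Fintype X] (K : Set (X → F)) : Set (X → F) :=
  {g | ∀ f ∈ K, ∑ x, f x * g x = 0}

/-- The coset `a + K`. -/
def coset {X : Type*} (a : X → F) (K : Set (X → F)) : Set (X → F) :=
  {v | ∃ u ∈ K, v = a + u}

/-- Rank of a collection of vectors: the dimension of its span. -/
noncomputable def rk {X : Type*} (K : Set (X → F)) : ℕ :=
  Module.finrank F (Submodule.span F K)

/-- `R + L` is everything: the full sum property for a pair of collections on `Y`. -/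
def FullSumSets {Y : Type*} (R L : Set (Y → F)) : Prop :=
  ∀ h : Y → F, ∃ u ∈ R, ∃ v ∈ L, h = u + v

/-- The vector on `S ⊎ P ⊎ Q` assembled from its three components. -/
def triple {S P Q : Type*} (f : S → F) (p : P → F) (g : Q → F) : S ⊕ (P ⊕ Q) → F :=
  Sum.elim f (Sum.elim p g)

/-- Extended sum of collections on `S ⊎ P` and `P ⊎ Q`, living on `S ⊎ P ⊎ Q`. -/
def extSum {S P Q : Type*} (K₁ : Set (S ⊕ P → F)) (K₂ : Set (P ⊕ Q → F)) :
    Set (S ⊕ (P ⊕ Q) → F) :=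
  {v | ∃ (f : S → F) (p₁ p₂ : P → F) (g : Q → F),
    Sum.elim f p₁ ∈ K₁ ∧ Sum.elim p₂ g ∈ K₂ ∧ v = triple f (p₁ + p₂) g}

/-- Extended intersection of collections on `S ⊎ P` and `P ⊎ Q`, living on `S ⊎ P ⊎ Q`. -/
def extInter {S P Q : Type*} (K₁ : Set (S ⊕ P → F)) (K₂ : Set (P ⊕ Q → F)) :
    Set (S ⊕ (P ⊕ Q) → F) :=
  {v | ∃ (f : S → F) (p : P → F) (g : Q → F),
    Sum.elim f p ∈ K₁ ∧ Sum.elim p g ∈ K₂ ∧ v = triple f p g}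

/-- Restriction of a collection on `S ⊎ P ⊎ Q` to `S ⊎ Q`. -/
def restrSQ {S P Q : Type*} (K : Set (S ⊕ (P ⊕ Q) → F)) : Set (S ⊕ Q → F) :=
  {w | ∃ p : P → F, triple (w ∘ Sum.inl) p (w ∘ Sum.inr) ∈ K}

/-- Contraction of a collection on `S ⊎ P ⊎ Q` to `S ⊎ Q`. -/
def contrSQ {S P Q : Type*} (K : Set (S ⊕ (P ⊕ Q) → F)) : Set (S ⊕ Q → F) :=
  {w | triple (w ∘ Sum.inl) (0 : P → F) (w ∘ Sum.inr) ∈ K}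

/-- `K_{(−P)Q}`: negate the `P`-components of all vectors of `K`. -/
def negL {P Q : Type*} (K : Set (P ⊕ Q → F)) : Set (P ⊕ Q → F) :=
  {v | Sum.elim (-(v ∘ Sum.inl)) (v ∘ Sum.inr) ∈ K}

/-- Direct sum of collections on `X` and on `Y`, living on `X ⊎ Y`. -/
def dsum {X Y : Type*} (K₁ : Set (X → F)) (K₂ : Set (Y → F)) : Set (X ⊕ Y → F) :=
  {h | h ∘ Sum.inl ∈ K₁ ∧ h ∘ Sum.inr ∈ K₂}

/-- Matched composition of a collection on `W ⊎ T ⊎ V` with one on `V`,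
yielding a collection on `W ⊎ T`. -/
def matchedTriple {W T V : Type*} (K : Set (W ⊕ (T ⊕ V) → F)) (L : Set (V → F)) :
    Set (W ⊕ T → F) :=
  {w | ∃ g ∈ L, Sum.elim (w ∘ Sum.inl) (Sum.elim (w ∘ Sum.inr) g) ∈ K}

/-- Extended sum of a collection on `W ⊎ T ⊎ V` with one on `V`. -/
def extSumV {W T V : Type*} (K : Set (W ⊕ (T ⊕ V) → F)) (L : Set (V → F)) :
    Set (W ⊕ (T ⊕ V) → F) :=
  {v | ∃ u ∈ K, ∃ g ∈ L, v = u + Sum.elim (0 : W → F) (Sum.elim (0 : T → F) g)}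

/-- Extended intersection of a collection on `W ⊎ T ⊎ V` with one on `V`. -/
def extInterV {W T V : Type*} (K : Set (W ⊕ (T ⊕ V) → F)) (L : Set (V → F)) :
    Set (W ⊕ (T ⊕ V) → F) :=
  {v | v ∈ K ∧ (fun x => v (Sum.inr (Sum.inr x))) ∈ L}

/-- Restriction of a collection on `W ⊎ T ⊎ V` to `T`. -/
def restrT {W T V : Type*} (K : Set (W ⊕ (T ⊕ V) → F)) : Set (T → F) :=
  {t | ∃ (w : W → F) (v : V → F), Sum.elim w (Sum.elim t v) ∈ K}

/-- Contraction of a collection on `W ⊎ T ⊎ V` to `T`. -/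
def contrT {W T V : Type*} (K : Set (W ⊕ (T ⊕ V) → F)) : Set (T → F) :=
  {t | Sum.elim (0 : W → F) (Sum.elim t (0 : V → F)) ∈ K}

/-- The image of a collection on `Y ⊎ Y` under the coordinate swap. -/
def swapSet {Y : Type*} (K : Set (Y ⊕ Y → F)) : Set (Y ⊕ Y → F) :=
  (fun v => Sum.elim (v ∘ Sum.inr) (v ∘ Sum.inl)) '' K

/-- A collection on `Y ⊎ Y` is Dirac iff its swap equals its orthogonal complement. -/
def IsDirac {Y : Type*} [Fintype Y] (K : Set (Y ⊕ Y → F)) : Prop :=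
  swapSet K = dualSet K

/-- `T` is column-independent in `K`: the only vector orthogonal to `K` and
supported inside `T` is zero. -/
def ColIndep {X : Type*} [Fintype X] (K : Set (X → F)) (T : Set X) : Prop :=
  ∀ g ∈ dualSet K, (∀ x ∉ T, g x = 0) → g = 0

/-- `T` is a column base of `K`: a column-independent set of size `rk K`. -/
def IsColBase {X : Type*} [Fintype X] (K : Set (X → F)) (T : Set X) : Prop :=
  ColIndep K T ∧ T.ncard = rk K


/-- Vectors on `S ⊎ P` extended by zero to `S ⊎ P ⊎ Q`. -/
def extendRight (F S P Q : Type*) [Field F] : (S ⊕ P → F) →ₗ[F] (S ⊕ (P ⊕ Q) → F) where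
  toFun v := triple (v ∘ Sum.inl) (v ∘ Sum.inr) 0
  map_add' u v := by ext (s | p | q) <;> simp [triple]
  map_smul' c v := by ext (s | p | q) <;> simp [triple]

/-- Vectors on `P ⊎ Q` extended by zero to `S ⊎ P ⊎ Q`. -/
def extendLeft (F S P Q : Type*) [Field F] : (P ⊕ Q → F) →ₗ[F] (S ⊕ (P ⊕ Q) → F) where
  toFun v := triple 0 (v ∘ Sum.inl) (v ∘ Sum.inr)
  map_add' u v := by ext (s | p | q) <;> simp [triple]
  map_smul' c v := by ext (s | p | q) <;> simp [triple]

/-- Vectors on `P` extended by zero to `S ⊎ P ⊎ Q`. -/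
def extendMid (F S P Q : Type*) [Field F] : (P → F) →ₗ[F] (S ⊕ (P ⊕ Q) → F) where
  toFun v := triple 0 v 0
  map_add' u v := by ext (s | p | q) <;> simp [triple]
  map_smul' c v := by ext (s | p | q) <;> simp [triple]

theorem triple_inj {R S P Q : Type*} {f f' : S → R} {p p' : P → R} {g g' : Q → R} :
    triple f p g = triple f' p' g' ↔ f = f' ∧ p = p' ∧ g = g' := by
  simp [triple, Sum.elim_eq_iff]

theorem extendRight_injective {S P Q : Type*} :
    Function.Injective (extendRight F S P Q) := by
  intro u v h
  obtain ⟨hl, hr, -⟩ := triple_inj.1 h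
  rw [← Sum.elim_comp_inl_inr u, hl, hr, Sum.elim_comp_inl_inr]

theorem extendLeft_injective {S P Q : Type*} :
    Function.Injective (extendLeft F S P Q) := by
  intro u v h
  obtain ⟨-, hl, hr⟩ := triple_inj.1 h
  rw [← Sum.elim_comp_inl_inr u, hl, hr, Sum.elim_comp_inl_inr]

theorem extendMid_injective {S P Q : Type*} :
    Function.Injective (extendMid F S P Q) :=
  fun _ _ h => (triple_inj.1 h).2.1

theorem rk_coe {X : Type*} (V : Submodule F (X → F)) :
    rk (V : Set (X → F)) = Module.finrank F V := by
  rw [rk, Submodule.span_eq]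

theorem extSum_coe {S P Q : Type*} (V₁ : Submodule F (S ⊕ P → F))
    (V₂ : Submodule F (P ⊕ Q → F)) :
    extSum (V₁ : Set (S ⊕ P → F)) (V₂ : Set (P ⊕ Q → F)) =
      (V₁.map (extendRight F S P Q) ⊔ V₂.map (extendLeft F S P Q) :
        Submodule F (S ⊕ (P ⊕ Q) → F)) := by
  have key : ∀ (f : S → F) (p₁ p₂ : P → F) (g : Q → F),
      extendRight F S P Q (Sum.elim f p₁) + extendLeft F S P Q (Sum.elim p₂ g) =
        triple f (p₁ + p₂) g := by
    intro f p₁ p₂ g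
    ext (s | p | q) <;> simp [extendRight, extendLeft, triple]
  ext v
  simp only [SetLike.mem_coe, Submodule.mem_sup, Submodule.mem_map]
  constructor
  · rintro ⟨f, p₁, p₂, g, h₁, h₂, rfl⟩
    exact ⟨_, ⟨_, h₁, rfl⟩, _, ⟨_, h₂, rfl⟩, key f p₁ p₂ g⟩
  · rintro ⟨_, ⟨u, hu, rfl⟩, _, ⟨w, hw, rfl⟩, rfl⟩
    refine ⟨u ∘ Sum.inl, u ∘ Sum.inr, w ∘ Sum.inl, w ∘ Sum.inr, ?_, ?_, ?_⟩
    · rwa [Sum.elim_comp_inl_inr]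
    · rwa [Sum.elim_comp_inl_inr]
    · rw [← key, Sum.elim_comp_inl_inr, Sum.elim_comp_inl_inr]

theorem contrR_inter_contrL_coe {S P Q : Type*} (V₁ : Submodule F (S ⊕ P → F))
    (V₂ : Submodule F (P ⊕ Q → F)) :
    contrR (V₁ : Set (S ⊕ P → F)) ∩ contrL (V₂ : Set (P ⊕ Q → F)) =
      ((V₁.map (extendRight F S P Q) ⊓ V₂.map (extendLeft F S P Q)).comap
        (extendMid F S P Q) : Submodule F (P → F)) := by
  ext p
  constructor
  · rintro ⟨h₁, h₂⟩
    exact ⟨⟨_, h₁, rfl⟩, ⟨_, h₂, rfl⟩⟩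
  · rintro ⟨⟨u, hu, hup⟩, ⟨w, hw, hwp⟩⟩
    obtain ⟨hul, hur, -⟩ := triple_inj.1 hup
    obtain ⟨-, hwl, hwr⟩ := triple_inj.1 hwp
    constructor
    · change Sum.elim (0 : S → F) p ∈ V₁
      rwa [← hul, ← hur, Sum.elim_comp_inl_inr]
    · change Sum.elim p (0 : Q → F) ∈ V₂
      rwa [← hwl, ← hwr, Sum.elim_comp_inl_inr]

theorem map_inf_map_le_range_extendMid {S P Q : Type*} (V₁ : Submodule F (S ⊕ P → F))
    (V₂ : Submodule F (P ⊕ Q → F)) :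
    V₁.map (extendRight F S P Q) ⊓ V₂.map (extendLeft F S P Q) ≤
      LinearMap.range (extendMid F S P Q) := by
  rintro _ ⟨⟨u, -, rfl⟩, ⟨w, -, hw⟩⟩
  obtain ⟨hl, -, -⟩ := triple_inj.1 hw
  exact ⟨u ∘ Sum.inr, triple_inj.2 ⟨hl, rfl, rfl⟩⟩

/-- `r(V₁) + r(V₂) = r(V₁ + V₂) + r(V₁×P ∩ V₂×P)` for vector spaces `V₁` on `S ⊎ P`
and `V₂` on `P ⊎ Q`, where `V₁ + V₂` is the extended sum on `S ⊎ P ⊎ Q`. -/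
theorem rank_sum_intersection {S P Q : Type*} [Fintype S] [Fintype P] [Fintype Q]
    (V₁ : Submodule F (S ⊕ P → F)) (V₂ : Submodule F (P ⊕ Q → F)) :
    Module.finrank F V₁ + Module.finrank F V₂
      = rk (extSum (V₁ : Set (S ⊕ P → F)) (V₂ : Set (P ⊕ Q → F)))
        + rk (contrR (V₁ : Set (S ⊕ P → F)) ∩ contrL (V₂ : Set (P ⊕ Q → F))) := by
  have hmid := LinearEquiv.finrank_eq (Submodule.equivMapOfInjective _
    (extendMid_injective (F := F) (S := S) (P := P) (Q := Q))
    ((V₁.map (extendRight F S P Q) ⊓ V₂.map (extendLeft F S P Q)).comap (extendMid F S P Q)))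
  rw [Submodule.map_comap_eq_of_le (map_inf_map_le_range_extendMid V₁ V₂)] at hmid
  rw [extSum_coe, contrR_inter_contrL_coe, rk_coe, rk_coe, hmid,
    Submodule.finrank_sup_add_finrank_inf_eq,
    LinearEquiv.finrank_eq (Submodule.equivMapOfInjective _ extendRight_injective V₁),
    LinearEquiv.finrank_eq (Submodule.equivMapOfInjective _ extendLeft_injective V₂)]

end ILA
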